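/- Let C be a monoidal category, e : C ≌ C a monoidal equivalence with functor α, tensorator η and inverse-counit isomorphism ξ, and let (X, ψ), (Y, φ) be objects of the Drinfeld center Z(C) with product half-braiding ψ̄_Z := (ψ_Z ⊗ id_Y) ∘ (id_X ⊗ φ_Z) on X ⊗ Y. Then the tensorator is a morphism of the center: for every object Z of C, (id_Z ⊗ η_{X,Y}) ∘ (ψ^α_Z ⊗ id_{αY}) ∘ (id_{αX} ⊗ φ^α_Z) = ψ̄^α_Z ∘ (η_{X,Y} ⊗ id_Z). Hence η_{X,Y} lifts to an isomorphism (α(X), ψ^α) ⊗ (α(Y), φ^α) ≅ (α(X ⊗ Y), ψ̄^α) in Z(C), making the induced functor on Z(C) monoidal. -/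

import Mathlib

open CategoryTheory MonoidalCategory

universe v u

namespace DrinfeldConj

variable {C : Type u} [Category.{v} C] [MonoidalCategory C]

/-- The conjugated half-braiding `ψ^α_Y := (ξ_Y⁻¹ ⊗ id_{αX}) ∘ η_{α⁻¹Y,X}⁻¹ ∘ α(ψ_{α⁻¹Y})
∘ η_{X,α⁻¹Y} ∘ (id_{αX} ⊗ ξ_Y)`, where `ξ_Y : Y ≅ α(α⁻¹Y)` is the inverse of the counit
isomorphism of the equivalence and `η` is the tensorator of `α`. -/
noncomputable def conj (α : C ⥤ C) [α.Monoidal] [α.IsEquivalence]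
    {X : C} (ψ : ∀ Y : C, X ⊗ Y ≅ Y ⊗ X) (Y : C) :
    α.obj X ⊗ Y ≅ Y ⊗ α.obj X :=
  whiskerLeftIso (α.obj X) (α.asEquivalence.counitIso.app Y).symm ≪≫
    Functor.Monoidal.μIso α X (α.asEquivalence.inverse.obj Y) ≪≫
    α.mapIso (ψ (α.asEquivalence.inverse.obj Y)) ≪≫
    (Functor.Monoidal.μIso α (α.asEquivalence.inverse.obj Y) X).symm ≪≫
    whiskerRightIso (α.asEquivalence.counitIso.app Y) (α.obj X)

/-- The product half-braiding `ψ̄_U := (ψ_U ⊗ id_Y) ∘ (id_X ⊗ φ_U)` on `X ⊗ Y`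
(with associators inserted). -/
def prodBraiding {X Y : C} (ψ : ∀ U : C, X ⊗ U ≅ U ⊗ X) (φ : ∀ U : C, Y ⊗ U ≅ U ⊗ Y)
    (U : C) : (X ⊗ Y) ⊗ U ≅ U ⊗ (X ⊗ Y) :=
  α_ X Y U ≪≫ whiskerLeftIso X (φ U) ≪≫ (α_ X U Y).symm ≪≫
    whiskerRightIso (ψ U) Y ≪≫ α_ U X Y

open Functor.LaxMonoidal Functor.OplaxMonoidal

/-- Every object `Z` is `α(W)` up to an isomorphism along which all conjugated half-braidings
at `Z` are computed. -/
theorem exists_conj_hom_eq (α : C ⥤ C) [α.Monoidal] [α.IsEquivalence] (Z : C) :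
    ∃ (W : C) (c : α.obj W ≅ Z), ∀ {X : C} (ψ : ∀ U : C, X ⊗ U ≅ U ⊗ X),
      (conj α ψ Z).hom = α.obj X ◁ c.inv ≫ μ α X W ≫ α.map (ψ W).hom ≫ δ α W X ≫
        c.hom ▷ α.obj X :=
  ⟨α.asEquivalence.inverse.obj Z, α.asEquivalence.counitIso.app Z, fun _ => rfl⟩

/-- The conjugated half-braiding, computed along any comparison `c : α(W) ⟶ Z`. -/
theorem whiskerLeft_conj_hom (α : C ⥤ C) [α.Monoidal] [α.IsEquivalence]
    {X : C} (ψ : ∀ U : C, X ⊗ U ≅ U ⊗ X)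
    (hψ : ∀ {U V : C} (f : U ⟶ V), (X ◁ f) ≫ (ψ V).hom = (ψ U).hom ≫ (f ▷ X))
    {W Z : C} (c : α.obj W ⟶ Z) :
    α.obj X ◁ c ≫ (conj α ψ Z).hom =
      μ α X W ≫ α.map (ψ W).hom ≫ δ α W X ≫ c ▷ α.obj X := by
  obtain ⟨V, d, hd⟩ := exists_conj_hom_eq α Z
  obtain ⟨g, hg⟩ := α.map_surjective (c ≫ d.inv)
  obtain rfl : c = α.map g ≫ d.hom := by simp [hg]
  rw [hd, ← MonoidalCategory.whiskerLeft_comp_assoc, Category.assoc, Iso.hom_inv_id,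
    Category.comp_id, μ_natural_right_assoc, ← α.map_comp_assoc, hψ, α.map_comp_assoc,
    ← δ_natural_left_assoc, comp_whiskerRight]

theorem conj_obj_hom (α : C ⥤ C) [α.Monoidal] [α.IsEquivalence]
    {X : C} (ψ : ∀ U : C, X ⊗ U ≅ U ⊗ X)
    (hψ : ∀ {U V : C} (f : U ⟶ V), (X ◁ f) ≫ (ψ V).hom = (ψ U).hom ≫ (f ▷ X)) (W : C) :
    (conj α ψ (α.obj W)).hom = μ α X W ≫ α.map (ψ W).hom ≫ δ α W X := by
  simpa using whiskerLeft_conj_hom α ψ hψ (𝟙 (α.obj W))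

theorem conj_naturality (α : C ⥤ C) [α.Monoidal] [α.IsEquivalence]
    {X : C} (ψ : ∀ U : C, X ⊗ U ≅ U ⊗ X)
    (hψ : ∀ {U V : C} (f : U ⟶ V), (X ◁ f) ≫ (ψ V).hom = (ψ U).hom ≫ (f ▷ X))
    {U V : C} (f : U ⟶ V) :
    (α.obj X ◁ f) ≫ (conj α ψ V).hom = (conj α ψ U).hom ≫ (f ▷ α.obj X) := by
  have c := α.objObjPreimageIso U
  rw [← cancel_epi (α.obj X ◁ c.hom), ← MonoidalCategory.whiskerLeft_comp_assoc,
    whiskerLeft_conj_hom α ψ hψ, ← Category.assoc (α.obj X ◁ c.hom),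
    whiskerLeft_conj_hom α ψ hψ]
  simp

/-- The hexagon for a natural family of morphisms is invariant under isomorphism of the
two objects it is evaluated at. -/
theorem hexagon_of_iso {A : C} (β : ∀ U : C, A ⊗ U ≅ U ⊗ A)
    (hβ : ∀ {U V : C} (f : U ⟶ V), (A ◁ f) ≫ (β V).hom = (β U).hom ≫ (f ▷ A))
    {U V U' V' : C} (c : U ≅ U') (d : V ≅ V')
    (h : (β (U ⊗ V)).hom = (α_ A U V).inv ≫ ((β U).hom ▷ V) ≫ (α_ U A V).hom ≫
      (U ◁ (β V).hom) ≫ (α_ U V A).inv) :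
    (β (U' ⊗ V')).hom = (α_ A U' V').inv ≫ ((β U').hom ▷ V') ≫ (α_ U' A V').hom ≫
      (U' ◁ (β V').hom) ≫ (α_ U' V' A).inv := by
  rw [← cancel_epi (A ◁ (c.hom ⊗ₘ d.hom)), hβ, h]
  symm
  calc
    _ = 𝟙 _ ⊗≫ (A ⊗ U) ◁ d.hom ⊗≫ (A ◁ c.hom ≫ (β U').hom) ▷ V' ⊗≫
          U' ◁ (β V').hom ⊗≫ 𝟙 _ := by
      rw [tensorHom_def']; monoidal
    _ = 𝟙 _ ⊗≫ ((A ⊗ U) ◁ d.hom ≫ (β U).hom ▷ V') ⊗≫ c.hom ▷ (A ⊗ V') ⊗≫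
          U' ◁ (β V').hom ⊗≫ 𝟙 _ := by
      rw [hβ]; monoidal
    _ = 𝟙 _ ⊗≫ (β U).hom ▷ V ⊗≫ U ◁ A ◁ d.hom ⊗≫ (c.hom ▷ (A ⊗ V') ≫
          U' ◁ (β V').hom) ⊗≫ 𝟙 _ := by
      rw [whisker_exchange]; monoidal
    _ = 𝟙 _ ⊗≫ (β U).hom ▷ V ⊗≫ U ◁ (A ◁ d.hom ≫ (β V').hom) ⊗≫
          c.hom ▷ (V' ⊗ A) ⊗≫ 𝟙 _ := by
      rw [← whisker_exchange]; monoidal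
    _ = _ := by
      rw [hβ, tensorHom_def']; monoidal

theorem conj_monoidal (α : C ⥤ C) [α.Monoidal] [α.IsEquivalence]
    {X : C} (ψ : ∀ U : C, X ⊗ U ≅ U ⊗ X)
    (hψ : ∀ {U V : C} (f : U ⟶ V), (X ◁ f) ≫ (ψ V).hom = (ψ U).hom ≫ (f ▷ X))
    (hψmon : ∀ U V : C, (ψ (U ⊗ V)).hom =
      (α_ X U V).inv ≫ ((ψ U).hom ▷ V) ≫ (α_ U X V).hom ≫ (U ◁ (ψ V).hom) ≫ (α_ U V X).inv)
    (U V : C) :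
    (conj α ψ (U ⊗ V)).hom = (α_ (α.obj X) U V).inv ≫ ((conj α ψ U).hom ▷ V) ≫
      (α_ U (α.obj X) V).hom ≫ (U ◁ (conj α ψ V).hom) ≫ (α_ U V (α.obj X)).inv := by
  refine hexagon_of_iso (conj α ψ) (conj_naturality α ψ hψ) (α.objObjPreimageIso U)
    (α.objObjPreimageIso V) ?_
  generalize α.objPreimage U = W
  generalize α.objPreimage V = W'
  rw [← cancel_epi (α.obj X ◁ δ α W W'), whiskerLeft_conj_hom α ψ hψ, hψmon,
    conj_obj_hom α ψ hψ, conj_obj_hom α ψ hψ]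
  simp only [Functor.map_comp, Functor.Monoidal.map_associator,
    Functor.Monoidal.map_associator_inv, Functor.Monoidal.map_whiskerLeft,
    Functor.Monoidal.map_whiskerRight, comp_whiskerRight, MonoidalCategory.whiskerLeft_comp,
    Category.assoc, Functor.Monoidal.μ_δ_assoc, Functor.Monoidal.whiskerRight_μ_δ,
    Category.comp_id]

theorem tensorator_conj (α : C ⥤ C) [α.Monoidal] [α.IsEquivalence]
    {X Y : C} (ψ : ∀ U : C, X ⊗ U ≅ U ⊗ X) (φ : ∀ U : C, Y ⊗ U ≅ U ⊗ Y) (Z : C) :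
    (α_ (α.obj X) (α.obj Y) Z).hom ≫ (α.obj X ◁ (conj α φ Z).hom) ≫
      (α_ (α.obj X) Z (α.obj Y)).inv ≫ ((conj α ψ Z).hom ▷ α.obj Y) ≫
      (α_ Z (α.obj X) (α.obj Y)).hom ≫ (Z ◁ μ α X Y) =
    (μ α X Y ▷ Z) ≫ (conj α (prodBraiding ψ φ) Z).hom := by
  obtain ⟨W, c, hc⟩ := exists_conj_hom_eq α Z
  rw [hc, hc, hc]
  simp only [prodBraiding, Iso.trans_hom, Iso.symm_hom, whiskerLeftIso_hom, whiskerRightIso_hom,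
    Functor.map_comp, Functor.Monoidal.map_associator, Functor.Monoidal.map_associator_inv,
    Functor.Monoidal.map_whiskerLeft,
    Functor.Monoidal.map_whiskerRight, comp_whiskerRight, MonoidalCategory.whiskerLeft_comp,
    Category.assoc, Functor.Monoidal.μ_δ_assoc]
  rw [← whisker_exchange_assoc, Functor.Monoidal.whiskerRight_μ_δ_assoc, whisker_exchange]
  simp

/-- the tensorator is a morphism of the center
`(id_Z ⊗ η_{X,Y}) ∘ (ψ^α_Z ⊗ id_{αY}) ∘ (id_{αX} ⊗ φ^α_Z) = ψ̄^α_Z ∘ (η_{X,Y} ⊗ id_Z)`,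
hence `η_{X,Y}` lifts to an isomorphism `(α(X), ψ^α) ⊗ (α(Y), φ^α) ≅ (α(X ⊗ Y), ψ̄^α)`
in `Z(C)`. -/
theorem tensorator_central (α : C ⥤ C) [α.Monoidal] [α.IsEquivalence]
    {X Y : C} (ψ : ∀ U : C, X ⊗ U ≅ U ⊗ X) (φ : ∀ U : C, Y ⊗ U ≅ U ⊗ Y)
    (hψnat : ∀ {U V : C} (f : U ⟶ V), (X ◁ f) ≫ (ψ V).hom = (ψ U).hom ≫ (f ▷ X))
    (hψmon : ∀ U V : C, (ψ (U ⊗ V)).hom =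
      (α_ X U V).inv ≫ ((ψ U).hom ▷ V) ≫ (α_ U X V).hom ≫ (U ◁ (ψ V).hom) ≫ (α_ U V X).inv)
    (hφnat : ∀ {U V : C} (f : U ⟶ V), (Y ◁ f) ≫ (φ V).hom = (φ U).hom ≫ (f ▷ Y))
    (hφmon : ∀ U V : C, (φ (U ⊗ V)).hom =
      (α_ Y U V).inv ≫ ((φ U).hom ▷ V) ≫ (α_ U Y V).hom ≫ (U ◁ (φ V).hom) ≫ (α_ U V Y).inv) :
    (∀ Z : C,
      (α_ (α.obj X) (α.obj Y) Z).hom ≫ (α.obj X ◁ (conj α φ Z).hom) ≫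
        (α_ (α.obj X) Z (α.obj Y)).inv ≫ ((conj α ψ Z).hom ▷ α.obj Y) ≫
        (α_ Z (α.obj X) (α.obj Y)).hom ≫ (Z ◁ Functor.LaxMonoidal.μ α X Y) =
      (Functor.LaxMonoidal.μ α X Y ▷ Z) ≫ (conj α (prodBraiding ψ φ) Z).hom) ∧
    ∃ (bX : HalfBraiding (α.obj X)) (bY : HalfBraiding (α.obj Y))
      (bXY : HalfBraiding (α.obj (X ⊗ Y)))
      (_ : ∀ U : C, bX.β U = conj α ψ U) (_ : ∀ U : C, bY.β U = conj α φ U)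
      (_ : ∀ U : C, bXY.β U = conj α (prodBraiding ψ φ) U)
      (i : Center.tensorObj (⟨α.obj X, bX⟩ : Center C) (⟨α.obj Y, bY⟩ : Center C) ≅
        (⟨α.obj (X ⊗ Y), bXY⟩ : Center C)),
      i.hom.f = Functor.LaxMonoidal.μ α X Y := by
  let hX : HalfBraiding X := ⟨ψ, hψmon, hψnat⟩
  let hY : HalfBraiding Y := ⟨φ, hφmon, hφnat⟩
  let hXY : HalfBraiding (X ⊗ Y) := (Center.tensorObj (⟨X, hX⟩ : Center C) ⟨Y, hY⟩).2
  let bX : HalfBraiding (α.obj X) :=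
    ⟨conj α ψ, conj_monoidal α ψ hψnat hψmon, conj_naturality α ψ hψnat⟩
  let bY : HalfBraiding (α.obj Y) :=
    ⟨conj α φ, conj_monoidal α φ hφnat hφmon, conj_naturality α φ hφnat⟩
  let bXY : HalfBraiding (α.obj (X ⊗ Y)) :=
    ⟨conj α (prodBraiding ψ φ), conj_monoidal α _ hXY.naturality hXY.monoidal,
      conj_naturality α _ hXY.naturality⟩
  let f : Center.tensorObj (⟨α.obj X, bX⟩ : Center C) ⟨α.obj Y, bY⟩ ⟶
      (⟨α.obj (X ⊗ Y), bXY⟩ : Center C) :=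
    { f := μ α X Y
      comm := fun U => by
        refine (tensorator_conj α ψ φ U).symm.trans ?_
        simp only [Center.tensorObj, bX, bY, Iso.trans_hom, Iso.symm_hom, whiskerLeftIso_hom,
          whiskerRightIso_hom, Category.assoc] }
  have : IsIso f.f := inferInstanceAs (IsIso (μ α X Y))
  exact ⟨tensorator_conj α ψ φ, bX, bY, bXY, fun _ => rfl, fun _ => rfl, fun _ => rfl,
    Center.isoMk f, rfl⟩

end DrinfeldConj
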